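/- arXiv:1010.2767 — 4 statements merged into one kernel-verified Lean document; each statement's English description precedes it below -/
import Mathlib

section
/- Let L be the lexsegment set of size d in R_t with t ≥ a−1, and let j = I(L) be the smallest integer i such that L^i is nonempty. Then d_{n,t} = Σ_{i=j}^{a−1} |L^i|^{<n−2>}. -/
open scoped Classical
open Finset

noncomputable section

/-- The monomials of degree `t` in `n` variables, identified with exponent vectors. -/
def degMon (n t : ℕ) : Finset (Fin n → ℕ) := Finset.Nat.antidiagonalTuple n t

/-- The exponent of `x_1` in a monomial. -/
def x1exp {n : ℕ} (m : Fin n → ℕ) : ℕ := if h : 0 < n then m ⟨0, h⟩ else 0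

/-- `lexLt u v` : `u` is lexicographically smaller than `v` as monomials
(with `x_1 > x_2 > ... > x_n`), i.e. `v > u`. -/
def lexLt {n : ℕ} (u v : Fin n → ℕ) : Prop :=
  ∃ i : Fin n, (∀ j : Fin n, j < i → u j = v j) ∧ u i < v i

/-- `M` is a lexsegment set inside the ground set `G` of monomials. -/
def IsLexSeg {n : ℕ} (G M : Finset (Fin n → ℕ)) : Prop :=
  M ⊆ G ∧ ∀ m ∈ M, ∀ v ∈ G, lexLt m v → v ∈ M

/-- The lexsegment set consisting of the top `d` monomials of `G` in the lex order. -/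
def lexSeg {n : ℕ} (G : Finset (Fin n → ℕ)) (d : ℕ) : Finset (Fin n → ℕ) :=
  G.filter (fun m => (G.filter (fun v => m = v ∨ lexLt m v)).card ≤ d)

/-- `S_1 · M` : all monomials `u * m` with `u` a variable and `m ∈ M`. -/
def S1mul (n : ℕ) (M : Finset (Fin n → ℕ)) : Finset (Fin n → ℕ) :=
  Finset.univ.biUnion (fun i : Fin n => M.image (fun m => m + Pi.single i 1))

/-- `S'_1 · M` : all monomials `x_i * m` with `2 ≤ i ≤ n` and `m ∈ M`. -/
def S1'mul (n : ℕ) (M : Finset (Fin n → ℕ)) : Finset (Fin n → ℕ) :=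
  (Finset.univ.filter (fun i : Fin n => (i : ℕ) ≠ 0)).biUnion
    (fun i => M.image (fun m => m + Pi.single i 1))

/-- `d^{<k>}` : the number of monomials obtained by multiplying each member of the
lexsegment set of `d` monomials of a fixed degree in `k+1` variables by each of the
`k+1` variables.  (We realize it in degree `d`, where the lexsegment set exists;
the number is independent of the chosen degree.  Also `0^{<k>} = 0`.) -/
def growth (d k : ℕ) : ℕ := (S1mul (k + 1) (lexSeg (degMon (k + 1) d) d)).card

/-- The monomials of `R_t` where `R = S/(x_1^a)` : degree-`t` monomials whose
`x_1`-exponent is at most `a - 1`. -/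
def RMon (n a t : ℕ) : Finset (Fin n → ℕ) :=
  (degMon n t).filter (fun m => x1exp m < a)

/-- `R_1 · M` : the monomials of `S_1 · M` not divisible by `x_1^a`. -/
def R1mul (n a : ℕ) (M : Finset (Fin n → ℕ)) : Finset (Fin n → ℕ) :=
  (S1mul n M).filter (fun m => x1exp m < a)

/-- `d_{n,t}` : the size of `R_1 · L` for the lexsegment set `L` of `d` monomials in `R_t`. -/
def dnt (n a t d : ℕ) : ℕ := (R1mul n a (lexSeg (RMon n a t) d)).card

/-- `M^i` : the monomials of `M` divisible by `x_1^i` but not by `x_1^{i+1}`. -/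
def comp {n : ℕ} (M : Finset (Fin n → ℕ)) (i : ℕ) : Finset (Fin n → ℕ) :=
  M.filter (fun m => x1exp m = i)

/-- `I(M)` : the smallest `i` such that `M^i ≠ ∅`. -/
def Imon {n : ℕ} (M : Finset (Fin n → ℕ)) : ℕ := sInf {i | (comp M i).Nonempty}

/-- `M` is Gotzmann in `S_t`. -/
def GotzmannS (n t : ℕ) (M : Finset (Fin n → ℕ)) : Prop :=
  (S1mul n (lexSeg (degMon n t) M.card)).card = (S1mul n M).card

/-- `M` is Gotzmann in `R_t`, `R = S/(x_1^a)`. -/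
def GotzmannR (n a t : ℕ) (M : Finset (Fin n → ℕ)) : Prop :=
  (R1mul n a (lexSeg (RMon n a t) M.card)).card = (R1mul n a M).card

/-- The monomials of degree `t` of `S' = F[x_2,...,x_n]`, viewed inside the `n`
variables as the monomials with `x_1`-exponent `0`. -/
def SpMon (n t : ℕ) : Finset (Fin n → ℕ) :=
  (degMon n t).filter (fun m => x1exp m = 0)

/-- `M` is Gotzmann in `S' = F[x_2,...,x_n]` (in degree `t`). -/
def GotzmannSp (n t : ℕ) (M : Finset (Fin n → ℕ)) : Prop :=
  (S1'mul n (lexSeg (SpMon n t) M.card)).card = (S1'mul n M).card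

/-- Dividing a monomial by the pure power of `x_1` it contains: set the first exponent to `0`. -/
def clearX1 {n : ℕ} (m : Fin n → ℕ) : Fin n → ℕ :=
  fun j => if (j : ℕ) = 0 then 0 else m j

/-- `M^i / x_1` : the monomials `m` of `S'` with `m * x_1^i ∈ M^i` (applied to `M = M^i`). -/
def divX1 {n : ℕ} (M : Finset (Fin n → ℕ)) : Finset (Fin n → ℕ) :=
  M.image clearX1

/-- `u · M` : the monomials `u * m` with `m ∈ M`. -/
def mulMon {n : ℕ} (u : Fin n → ℕ) (M : Finset (Fin n → ℕ)) : Finset (Fin n → ℕ) :=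
  M.image (fun m => u + m)

/-- The set `B` of degree-`t` monomials of `S` divisible by `x_1^a`. -/
def Bset (n a t : ℕ) : Finset (Fin n → ℕ) :=
  (degMon n t).filter (fun m => a ≤ x1exp m)

theorem mem_degMon' {n t : ℕ} (m : Fin n → ℕ) : m ∈ degMon n t ↔ ∑ i, m i = t := by
  unfold degMon; exact Finset.Nat.mem_antidiagonalTuple

theorem mem_S1mul' {n : ℕ} (M : Finset (Fin n → ℕ)) (m : Fin n → ℕ) :
    m ∈ S1mul n M ↔ ∃ p : Fin n, ∃ l ∈ M, l + Pi.single p 1 = m := by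
  simp [S1mul]

theorem lexLt_iff' {n : ℕ} (u v : Fin n → ℕ) : lexLt u v ↔ toLex u < toLex v := Iff.rfl

theorem lexLt_tri {n : ℕ} (u v : Fin n → ℕ) : lexLt u v ∨ u = v ∨ lexLt v u := by
  rw [lexLt_iff', lexLt_iff']
  rcases lt_trichotomy (toLex u) (toLex v) with h | h | h
  · exact Or.inl h
  · exact Or.inr (Or.inl (toLex.injective h))
  · exact Or.inr (Or.inr h)

theorem lexLt_trans' {n : ℕ} {u v w : Fin n → ℕ} (h : lexLt u v) (h' : lexLt v w) :
    lexLt u w := by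
  rw [lexLt_iff'] at *
  exact h.trans h'

theorem lexLt_irrefl' {n : ℕ} (u : Fin n → ℕ) : ¬ lexLt u u := by
  rw [lexLt_iff']
  exact lt_irrefl _

def rk {n : ℕ} (G : Finset (Fin n → ℕ)) (m : Fin n → ℕ) : ℕ :=
  (G.filter (fun v => m = v ∨ lexLt m v)).card

theorem rk_lt {n : ℕ} {G : Finset (Fin n → ℕ)} {u v : Fin n → ℕ} (hu : u ∈ G)
    (h : lexLt u v) : rk G v < rk G u := by
  unfold rk
  apply Finset.card_lt_card
  rw [Finset.ssubset_iff_of_subset]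
  · refine ⟨u, by simp [hu], ?_⟩
    simp only [Finset.mem_filter, not_and, not_or]
    intro _
    refine ⟨?_, fun h' => lexLt_irrefl' _ (lexLt_trans' h h')⟩
    rintro rfl
    exact lexLt_irrefl' _ h
  · intro w hw
    simp only [Finset.mem_filter] at hw ⊢
    refine ⟨hw.1, Or.inr ?_⟩
    rcases hw.2 with rfl | h'
    · exact h
    · exact lexLt_trans' h h'

theorem rk_injOn {n : ℕ} (G : Finset (Fin n → ℕ)) : Set.InjOn (rk G) G := by
  intro u hu v hv h
  rcases lexLt_tri u v with h' | h' | h'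
  · have := rk_lt hu h'; omega
  · exact h'
  · have := rk_lt hv h'; omega

theorem lexSeg_isLexSeg {n : ℕ} (G : Finset (Fin n → ℕ)) (d : ℕ) : IsLexSeg G (lexSeg G d) := by
  refine ⟨Finset.filter_subset _ _, ?_⟩
  intro m hm v hv h
  have h1 := Finset.mem_filter.1 hm
  have h2 : rk G m ≤ d := h1.2
  have := rk_lt h1.1 h
  exact Finset.mem_filter.2 ⟨hv, (by show rk G v ≤ d; omega)⟩

theorem lexSeg_card {n : ℕ} (G : Finset (Fin n → ℕ)) (d : ℕ) (hd : d ≤ G.card) :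
    (lexSeg G d).card = d := by
  have himg : G.image (rk G) = Finset.Icc 1 G.card := by
    apply Finset.eq_of_subset_of_card_le
    · intro x hx
      obtain ⟨m, hm, rfl⟩ := Finset.mem_image.1 hx
      rw [Finset.mem_Icc]
      refine ⟨?_, Finset.card_le_card (Finset.filter_subset _ _)⟩
      exact Finset.card_pos.2 ⟨m, by simp [hm]⟩
    · rw [Finset.card_image_of_injOn (rk_injOn G)]; simp
  have h2 : (lexSeg G d).image (rk G) = Finset.Icc 1 d := by
    ext x
    rw [Finset.mem_image, Finset.mem_Icc]
    constructor
    · rintro ⟨m, hm, rfl⟩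
      have h1 := Finset.mem_filter.1 hm
      have h3 : rk G m ∈ Finset.Icc 1 G.card := himg ▸ Finset.mem_image_of_mem _ h1.1
      exact ⟨(Finset.mem_Icc.1 h3).1, h1.2⟩
    · rintro ⟨h1, h3⟩
      have : x ∈ G.image (rk G) := by rw [himg, Finset.mem_Icc]; omega
      obtain ⟨m, hm, rfl⟩ := Finset.mem_image.1 this
      exact ⟨m, Finset.mem_filter.2 ⟨hm, h3⟩, rfl⟩
  have h3 := Finset.card_image_of_injOn
    ((rk_injOn G).mono (Finset.coe_subset.2 (lexSeg_isLexSeg G d).1))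
  rw [h2] at h3
  simpa using h3.symm

theorem IsLexSeg.uniq {n : ℕ} {G A B : Finset (Fin n → ℕ)} (hA : IsLexSeg G A)
    (hB : IsLexSeg G B) (h : A.card = B.card) : A = B := by
  by_cases hs : A ⊆ B
  · exact Finset.eq_of_subset_of_card_le hs h.ge
  · obtain ⟨u, hu, hu'⟩ := Finset.not_subset.1 hs
    symm
    refine Finset.eq_of_subset_of_card_le ?_ h.le
    intro v hv
    rcases lexLt_tri u v with h' | h' | h'
    · exact hA.2 u hu v (hB.1 hv) h'
    · exact h' ▸ hu
    · exact absurd (hB.2 v hv u (hA.1 hu) h') hu'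

def shift (k c : ℕ) (m : Fin (k+1) → ℕ) : Fin (k+1) → ℕ := m + Pi.single 0 c

theorem shift_inj (k c : ℕ) : Function.Injective (shift k c) := fun _ _ h => add_right_cancel h

theorem shift_isLexSeg {k s : ℕ} {A : Finset (Fin (k+1) → ℕ)} (c : ℕ)
    (hA : IsLexSeg (degMon (k+1) s) A) : IsLexSeg (degMon (k+1) (s+c)) (A.image (shift k c)) := by
  constructor
  · intro x hx
    obtain ⟨m, hm, rfl⟩ := Finset.mem_image.1 hx
    have := (mem_degMon' m).1 (hA.1 hm)
    rw [mem_degMon']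
    simp [shift, Finset.sum_add_distrib, this]
  · intro x hx v hv hlt
    obtain ⟨m, hm, rfl⟩ := Finset.mem_image.1 hx
    obtain ⟨i, hi, hi'⟩ := hlt
    have hc : c ≤ v 0 := by
      rcases Fin.eq_zero_or_eq_succ i with rfl | ⟨i', rfl⟩
      · simp [shift] at hi'; omega
      · have := hi 0 (Fin.succ_pos _)
        simp [shift] at this; omega
    have hex : ∃ w : Fin (k+1) → ℕ, shift k c w = v := by
      refine ⟨v - Pi.single 0 c, ?_⟩
      funext q
      rcases Fin.eq_zero_or_eq_succ q with rfl | ⟨q', rfl⟩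
      · simp [shift]; omega
      · simp [shift]
    obtain ⟨w, rfl⟩ := hex
    refine Finset.mem_image_of_mem _ ?_
    refine hA.2 m hm w ?_ ⟨i, ?_, ?_⟩
    · rw [mem_degMon'] at hv ⊢
      simp [shift, Finset.sum_add_distrib] at hv
      exact hv
    · intro j hj
      have := hi j hj
      simpa [shift] using this
    · simpa [shift] using hi'

theorem S1mul_shift (k c : ℕ) (A : Finset (Fin (k+1) → ℕ)) :
    (S1mul (k+1) (A.image (shift k c))).card = (S1mul (k+1) A).card := by
  rw [← Finset.card_image_of_injective (S1mul (k+1) A) (shift_inj k c)]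
  congr 1
  ext x
  simp only [mem_S1mul', Finset.mem_image]
  constructor
  · rintro ⟨p, _, ⟨m, hm, rfl⟩, rfl⟩
    exact ⟨_, ⟨p, m, hm, rfl⟩, by simp only [shift]; abel⟩
  · rintro ⟨_, ⟨p, m, hm, rfl⟩, rfl⟩
    exact ⟨p, _, ⟨m, hm, rfl⟩, by simp only [shift]; abel⟩

theorem degMon_card_ge {k s : ℕ} {A : Finset (Fin (k+1) → ℕ)} (hA : A ⊆ degMon (k+1) s) :
    A.card ≤ (degMon (k+1) A.card).card := by
  rcases k with _ | k
  · have h1 : A.card ≤ 1 := by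
      rw [Finset.card_le_one]
      intro u hu v hv
      have h1 := (mem_degMon' u).1 (hA hu)
      have h2 := (mem_degMon' v).1 (hA hv)
      funext q
      fin_cases q
      simp at h1 h2 ⊢
      omega
    have h2 : 0 < (degMon (0+1) A.card).card :=
      Finset.card_pos.2 ⟨Pi.single 0 A.card, by rw [mem_degMon']; simp⟩
    omega
  · generalize A.card = c
    have : ((Finset.range c).image
        (fun i => (Pi.single 0 i + Pi.single 1 (c - i) : Fin (k+1+1) → ℕ))).card = c := by
      rw [Finset.card_image_of_injective, Finset.card_range]
      intro i j h
      have := congrFun h 0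
      simpa using this
    rw [← this]
    apply Finset.card_le_card
    rw [this]
    intro x hx
    obtain ⟨i, hi, rfl⟩ := Finset.mem_image.1 hx
    rw [Finset.mem_range] at hi
    rw [mem_degMon']
    simp [Finset.sum_add_distrib]
    omega

theorem growth_eq {k s : ℕ} {A : Finset (Fin (k+1) → ℕ)} (hA : IsLexSeg (degMon (k+1) s) A) :
    (S1mul (k+1) A).card = growth A.card k := by
  unfold growth
  have hB := lexSeg_isLexSeg (degMon (k+1) A.card) A.card
  have hBc := lexSeg_card (degMon (k+1) A.card) A.card (degMon_card_ge hA.1)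
  generalize lexSeg (degMon (k+1) A.card) A.card = B at hB hBc
  rcases le_total s A.card with h | h
  · obtain ⟨c, hc⟩ := Nat.exists_eq_add_of_le h
    rw [hc] at hB
    have := (shift_isLexSeg c hA).uniq hB
      (by rw [Finset.card_image_of_injective _ (shift_inj k c), hBc])
    rw [← this, S1mul_shift]
  · obtain ⟨c, hc⟩ := Nat.exists_eq_add_of_le h
    have h1 := shift_isLexSeg c hB
    rw [← hc] at h1
    have := h1.uniq hA (by rw [Finset.card_image_of_injective _ (shift_inj k c), hBc])
    rw [← this, S1mul_shift]

def xslice {k : ℕ} (L : Finset (Fin (k+2) → ℕ)) (i : ℕ) : Finset (Fin (k+1) → ℕ) :=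
  (comp L i).image Fin.tail

theorem x1exp_eq {k : ℕ} (m : Fin (k+2) → ℕ) : x1exp m = m 0 := by simp [x1exp]

theorem mem_xslice {k : ℕ} (L : Finset (Fin (k+2) → ℕ)) (i : ℕ) (u : Fin (k+1) → ℕ) :
    u ∈ xslice L i ↔ (Fin.cons i u : Fin (k+2) → ℕ) ∈ L := by
  simp only [xslice, comp, Finset.mem_image, Finset.mem_filter, x1exp_eq]
  constructor
  · rintro ⟨m, ⟨hm, rfl⟩, rfl⟩
    rwa [Fin.cons_self_tail]
  · intro h
    exact ⟨_, ⟨h, by simp⟩, by simp⟩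

theorem slice_card {k : ℕ} (L : Finset (Fin (k+2) → ℕ)) (i : ℕ) :
    (xslice L i).card = (comp L i).card := by
  apply Finset.card_image_of_injOn
  intro u hu v hv h
  simp only [comp, Finset.coe_filter, Set.mem_ofPred_eq, x1exp_eq] at hu hv
  rw [← Fin.cons_self_tail u, ← Fin.cons_self_tail v, h, hu.2, hv.2]

theorem mem_RMon {k a t : ℕ} (i : ℕ) (u : Fin (k+1) → ℕ) :
    (Fin.cons i u : Fin (k+2) → ℕ) ∈ RMon (k+2) a t ↔ i + ∑ q, u q = t ∧ i < a := by
  simp only [RMon, Finset.mem_filter, mem_degMon', x1exp_eq, Fin.cons_zero]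
  rw [Fin.sum_univ_succ]
  simp

theorem slice_isLexSeg {k a t i : ℕ} {L : Finset (Fin (k+2) → ℕ)} (hL : IsLexSeg (RMon (k+2) a t) L)
    (hi : i < a) (hit : i ≤ t) : IsLexSeg (degMon (k+1) (t-i)) (xslice L i) := by
  constructor
  · intro u hu
    rw [mem_xslice] at hu
    have := (mem_RMon _ _).1 (hL.1 hu)
    rw [mem_degMon']
    omega
  · intro u hu v hv h
    rw [mem_xslice] at hu ⊢
    rw [mem_degMon'] at hv
    refine hL.2 _ hu _ ((mem_RMon _ _).2 ⟨by omega, hi⟩) ?_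
    obtain ⟨p, h1, h2⟩ := h
    refine ⟨p.succ, ?_, by simpa using h2⟩
    intro j hj
    rcases Fin.eq_zero_or_eq_succ j with rfl | ⟨j, rfl⟩
    · simp
    · simpa using h1 j (by simpa using hj)

theorem cons_add_succ {k : ℕ} (i : ℕ) (u : Fin (k+1) → ℕ) (p : Fin (k+1)) :
    (Fin.cons i u : Fin (k+2) → ℕ) + Pi.single p.succ 1 = Fin.cons i (u + Pi.single p 1) := by
  funext q
  rcases Fin.eq_zero_or_eq_succ q with rfl | ⟨q, rfl⟩
  · simp [Pi.single_apply, (Fin.succ_ne_zero p).symm]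
  · simp [Pi.single_apply]

theorem comp_R1mul {k a t i : ℕ} {L : Finset (Fin (k+2) → ℕ)} (hL : IsLexSeg (RMon (k+2) a t) L)
    (hi : i < a) (hit : i ≤ t) :
    comp (R1mul (k+2) a L) i
      = (S1mul (k+1) (xslice L i)).image (fun u => (Fin.cons i u : Fin (k+2) → ℕ)) := by
  ext x
  simp only [comp, R1mul, Finset.mem_filter, Finset.mem_image, mem_S1mul', x1exp_eq]
  constructor
  · rintro ⟨⟨⟨p, l, hl, rfl⟩, _⟩, h0⟩
    rw [← Fin.cons_self_tail l] at hl h0 ⊢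
    generalize l 0 = b at *
    generalize Fin.tail l = u at *
    rcases Fin.eq_zero_or_eq_succ p with rfl | ⟨p, rfl⟩
    · simp at h0
      have hR := (mem_RMon _ _).1 (hL.1 hl)
      have hne : ∑ q, u q ≠ 0 := by omega
      obtain ⟨q, _, hq⟩ := Finset.exists_ne_zero_of_sum_ne_zero hne
      have hu : (u - Pi.single q 1) + Pi.single q 1 = u := by
        funext r
        by_cases hr : r = q
        · subst hr; simp; omega
        · simp [hr]
      generalize u - Pi.single q 1 = w at hu
      subst hu
      refine ⟨w + Pi.single q 1, ⟨q, w, ?_, rfl⟩, ?_⟩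
      · rw [mem_xslice]
        refine hL.2 _ hl _ ?_ ⟨0, ?_, ?_⟩
        · rw [mem_RMon]
          have h1 := hR.1
          simp [Finset.sum_add_distrib] at h1
          omega
        · intro j hj; simp at hj
        · simp; omega
      · funext r
        rcases Fin.eq_zero_or_eq_succ r with rfl | ⟨r, rfl⟩
        · simp [h0]
        · simp
    · rw [cons_add_succ] at h0 ⊢
      simp at h0
      subst h0
      exact ⟨_, ⟨p, u, (mem_xslice _ _ _).2 hl, rfl⟩, rfl⟩
  · rintro ⟨_, ⟨p, u, hu, rfl⟩, rfl⟩
    rw [mem_xslice] at hu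
    refine ⟨⟨⟨p.succ, _, hu, cons_add_succ _ _ _⟩, ?_⟩, ?_⟩
    · simpa using hi
    · simp

/-- Let `L` be the lexsegment set of size `d` in `R_t` with `t ≥ a - 1`,
and let `j = I(L)`.  Then `d_{n,t} = Σ_{i=j}^{a-1} |L^i|^{<n-2>}`. -/
theorem stmt_0 (n a t d : ℕ) (hn : 2 ≤ n) (ha : 1 ≤ a) (ht : a - 1 ≤ t)
    (hd0 : 0 < d) (hd : d < (RMon n a t).card) :
    dnt n a t d =
      ∑ i ∈ Finset.Icc (Imon (lexSeg (RMon n a t) d)) (a - 1),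
        growth ((comp (lexSeg (RMon n a t) d) i).card) (n - 2) := by
  obtain ⟨k, rfl⟩ := Nat.exists_eq_add_of_le' hn
  unfold dnt
  have hL := lexSeg_isLexSeg (RMon (k+2) a t) d
  generalize lexSeg (RMon (k+2) a t) d = L at hL
  have key : ∀ i ∈ Finset.range a,
      (comp (R1mul (k+2) a L) i).card = growth ((comp L i).card) (k+2-2) := by
    intro i hi
    rw [Finset.mem_range] at hi
    have hinj : Function.Injective (fun u : Fin (k+1) → ℕ => (Fin.cons i u : Fin (k+2) → ℕ)) := by
      intro u v h
      funext q
      simpa using congrFun h q.succ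
    rw [comp_R1mul hL hi (by omega), Finset.card_image_of_injective _ hinj,
      growth_eq (slice_isLexSeg hL hi (by omega)), slice_card]
    rfl
  have h1 : (R1mul (k+2) a L).card = ∑ i ∈ Finset.range a, (comp (R1mul (k+2) a L) i).card := by
    apply Finset.card_eq_sum_card_fiberwise
    intro x hx
    have := (Finset.mem_filter.1 hx).2
    simpa using this
  rw [h1, Finset.sum_congr rfl key]
  symm
  apply Finset.sum_subset
  · intro i hi
    rw [Finset.mem_Icc] at hi
    rw [Finset.mem_range]; omega
  · intro i hi hi'
    rw [Finset.mem_range] at hi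
    rw [Finset.mem_Icc] at hi'
    have hlt : i < Imon L := by omega
    have he := Nat.notMem_of_lt_sInf hlt
    simp only [Set.mem_ofPred_eq, Finset.not_nonempty_iff_eq_empty] at he
    rw [← key i (by simpa using hi), comp_R1mul hL hi (by omega)]
    rw [Finset.card_eq_zero, Finset.image_eq_empty, Finset.eq_empty_iff_forall_notMem]
    intro x hx
    rw [mem_S1mul'] at hx
    obtain ⟨p, l, hl, _⟩ := hx
    simp [xslice, he] at hl
end
end

section
/- Let M be a set of monomials in R_t with t ≥ a, and let B denote the set of monomials of degree t in S divisible by x_1^a. Then S_1·(B ∪ M) is the disjoint union of S_1·B and R_1·M. -/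
open scoped Classical
open Finset

noncomputable section

theorem mem_S1mul_iff {n : ℕ} {M : Finset (Fin n → ℕ)} {v : Fin n → ℕ} :
    v ∈ S1mul n M ↔ ∃ i : Fin n, ∃ m ∈ M, m + Pi.single i 1 = v := by
  simp [S1mul]

theorem key_aux (n a t : ℕ) (hta : a ≤ t) (m : Fin n → ℕ) (hm : m ∈ RMon n a t) (i : Fin n)
    (h : a ≤ x1exp (m + Pi.single i 1)) : m + Pi.single i 1 ∈ S1mul n (Bset n a t) := by
  have hn : 0 < n := i.pos
  simp only [RMon, degMon, Finset.mem_filter, Finset.Nat.mem_antidiagonalTuple, x1exp, hn,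
    dif_pos] at hm
  obtain ⟨hs, hlt⟩ := hm
  simp only [x1exp, hn, dif_pos, Pi.add_apply] at h
  have hi : i = ⟨0, hn⟩ := by
    by_contra hne
    rw [Pi.single_eq_of_ne (Ne.symm hne)] at h
    omega
  subst hi
  have hj : ∃ j : Fin n, j ≠ ⟨0, hn⟩ ∧ 0 < m j := by
    by_contra! hc
    have : ∑ k, m k = m ⟨0, hn⟩ := by
      apply Finset.sum_eq_single_of_mem _ (Finset.mem_univ _)
      intro b _ hb
      have := hc b hb
      omega
    omega
  obtain ⟨j, hj0, hjp⟩ := hj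
  have hle : Pi.single j 1 ≤ m := by
    intro k
    by_cases hk : k = j
    · subst hk; simp; omega
    · simp [Pi.single_eq_of_ne hk]
  obtain ⟨m', rfl⟩ : ∃ m', m = m' + Pi.single j 1 := ⟨m - Pi.single j 1, by
    rw [tsub_add_cancel_of_le hle]⟩
  rw [mem_S1mul_iff]
  refine ⟨j, m' + Pi.single ⟨0, hn⟩ 1, ?_, by abel⟩
  simp only [Bset, degMon, Finset.mem_filter, Finset.Nat.mem_antidiagonalTuple, x1exp, hn,
    dif_pos]
  constructor
  · simp only [Pi.add_apply, Finset.sum_add_distrib, Finset.sum_pi_single', Finset.mem_univ,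
      if_true, Finset.sum_pi_single] at hs ⊢
    simpa using hs
  · simp only [Pi.add_apply, Pi.single_eq_of_ne (Ne.symm hj0)] at h ⊢
    omega

/-- Let `M` be a set of monomials in `R_t` with `t ≥ a`, and let `B` be
the set of degree-`t` monomials of `S` divisible by `x_1^a`.  Then
`S_1·(B ∪ M)` is the disjoint union of `S_1·B` and `R_1·M`. -/
theorem stmt_2 (n a t : ℕ) (ha : 1 ≤ a) (hta : a ≤ t)
    (M : Finset (Fin n → ℕ)) (hM : M ⊆ RMon n a t) :
    S1mul n (Bset n a t ∪ M) = S1mul n (Bset n a t) ∪ R1mul n a M ∧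
      Disjoint (S1mul n (Bset n a t)) (R1mul n a M) := by
  constructor
  · ext v
    simp only [Finset.mem_union, R1mul, Finset.mem_filter]
    constructor
    · intro hv
      obtain ⟨i, m, hm, rfl⟩ := mem_S1mul_iff.1 hv
      rcases Finset.mem_union.1 hm with hm | hm
      · exact Or.inl (mem_S1mul_iff.2 ⟨i, m, hm, rfl⟩)
      · by_cases h : a ≤ x1exp (m + Pi.single i 1)
        · exact Or.inl (key_aux n a t hta m (hM hm) i h)
        · exact Or.inr ⟨mem_S1mul_iff.2 ⟨i, m, hm, rfl⟩, not_le.1 h⟩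
    · rintro (hv | ⟨hv, -⟩)
      · obtain ⟨i, m, hm, rfl⟩ := mem_S1mul_iff.1 hv
        exact mem_S1mul_iff.2 ⟨i, m, Finset.mem_union_left _ hm, rfl⟩
      · obtain ⟨i, m, hm, rfl⟩ := mem_S1mul_iff.1 hv
        exact mem_S1mul_iff.2 ⟨i, m, Finset.mem_union_right _ hm, rfl⟩
  · rw [Finset.disjoint_left]
    intro v hv hv'
    obtain ⟨i, m, hm, rfl⟩ := mem_S1mul_iff.1 hv
    have h1 := (Finset.mem_filter.1 hv').2
    have h2 := (Finset.mem_filter.1 hm).2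
    have hn : 0 < n := i.pos
    simp only [x1exp, hn, dif_pos, Pi.add_apply] at h1 h2
    omega
end
end

section
/- Let M be a set of monomials in R_t with t ≥ a, and let B denote the set of monomials of degree t in S divisible by x_1^a. Then M is Gotzmann in R_t if and only if B ∪ M is Gotzmann in S_t. -/
open scoped Classical
open Finset

noncomputable section

theorem mem_degMon_aux {n t : ℕ} {m : Fin n → ℕ} : m ∈ degMon n t ↔ ∑ i, m i = t := by
  simp [degMon, Finset.Nat.mem_antidiagonalTuple]

theorem x1exp_succ_aux {n : ℕ} (m : Fin (n+1) → ℕ) : x1exp m = m 0 := by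
  simp [x1exp]

theorem mem_S1mul_aux {n : ℕ} {M : Finset (Fin n → ℕ)} {m : Fin n → ℕ} :
    m ∈ S1mul n M ↔ ∃ i, ∃ u ∈ M, u + Pi.single i 1 = m := by
  simp [S1mul]

theorem lexLt_x1_aux {n : ℕ} {u v : Fin (n+1) → ℕ} (h : lexLt u v) : u 0 ≤ v 0 := by
  obtain ⟨i, h1, h2⟩ := h
  rcases Fin.eq_zero_or_eq_succ i with rfl | ⟨j, rfl⟩
  · exact h2.le
  · exact (h1 0 (Fin.succ_pos j)).le

theorem lexLt_of_x1_aux {n : ℕ} {u v : Fin (n+1) → ℕ} (h : u 0 < v 0) : lexLt u v :=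
  ⟨0, fun j hj => absurd hj (Fin.not_lt_zero j), h⟩

theorem disj_aux {n a t : ℕ} {X : Finset (Fin n → ℕ)} (hX : X ⊆ RMon n a t) :
    Disjoint (Bset n a t) X := by
  rw [Finset.disjoint_left]
  intro m hm hx
  have h1 := (Finset.mem_filter.1 hm).2
  have h2 := (Finset.mem_filter.1 (hX hx)).2
  omega

theorem lexSeg_aux {n a t d : ℕ} :
    lexSeg (degMon (n+1) t) ((Bset (n+1) a t).card + d) =
      Bset (n+1) a t ∪ lexSeg (RMon (n+1) a t) d := by
  ext m
  by_cases hm : m ∈ degMon (n+1) t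
  swap
  · constructor
    · intro h
      exact absurd (Finset.mem_filter.1 h).1 hm
    · intro h
      rcases Finset.mem_union.1 h with h | h
      · exact absurd (Finset.mem_filter.1 h).1 hm
      · exact absurd (Finset.mem_filter.1 (Finset.mem_filter.1 h).1).1 hm
  by_cases hb : a ≤ m 0
  · have : m ∈ Bset (n+1) a t := by simp [Bset, hm, x1exp_succ_aux, hb]
    simp only [Finset.mem_union, this, true_or, iff_true]
    refine Finset.mem_filter.2 ⟨hm, ?_⟩
    refine le_trans (Finset.card_le_card ?_) (Nat.le_add_right _ _)
    intro v hv
    obtain ⟨hv, h⟩ := Finset.mem_filter.1 hv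
    refine Finset.mem_filter.2 ⟨hv, ?_⟩
    rw [x1exp_succ_aux]
    rcases h with rfl | h
    · exact hb
    · exact hb.trans (lexLt_x1_aux h)
  · have h1 : m ∉ Bset (n+1) a t := by simp [Bset, x1exp_succ_aux, hb]
    have h2 : m ∈ RMon (n+1) a t := by
      simp only [RMon, Finset.mem_filter, x1exp_succ_aux]; exact ⟨hm, by omega⟩
    have h3 : (degMon (n+1) t).filter (fun v => m = v ∨ lexLt m v) =
        Bset (n+1) a t ∪ (RMon (n+1) a t).filter (fun v => m = v ∨ lexLt m v) := by
      ext v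
      simp only [Bset, RMon, Finset.mem_filter, Finset.mem_union, x1exp_succ_aux]
      constructor
      · rintro ⟨hv, h⟩
        rcases le_or_gt a (v 0) with h' | h'
        · exact Or.inl ⟨hv, h'⟩
        · exact Or.inr ⟨⟨hv, h'⟩, h⟩
      · rintro (⟨hv, h⟩ | ⟨⟨hv, _⟩, h⟩)
        · exact ⟨hv, Or.inr (lexLt_of_x1_aux (by omega))⟩
        · exact ⟨hv, h⟩
    simp only [Finset.mem_union, h1, false_or, lexSeg, Finset.mem_filter (s := degMon _ _),
      Finset.mem_filter (s := RMon _ _ _), hm, h2, true_and, h3]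
    rw [Finset.card_union_of_disjoint (disj_aux (Finset.filter_subset _ _))]
    omega

theorem S1mul_card_aux {n a t : ℕ} (hta : a ≤ t) {X : Finset (Fin (n+1) → ℕ)}
    (hX : X ⊆ RMon (n+1) a t) :
    (S1mul (n+1) (Bset (n+1) a t ∪ X)).card =
      (R1mul (n+1) a X).card + (Bset (n+1) a (t+1)).card := by
  rw [← Finset.card_filter_add_card_filter_not (fun m => x1exp m < a)]
  congr 2
  · ext m
    simp only [R1mul, Finset.mem_filter, mem_S1mul_aux, Finset.mem_union]
    constructor
    · rintro ⟨⟨i, u, hu | hu, rfl⟩, h⟩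
      · have := (Finset.mem_filter.1 hu).2
        simp only [x1exp_succ_aux, Pi.add_apply] at *
        omega
      · exact ⟨⟨i, u, hu, rfl⟩, h⟩
    · rintro ⟨⟨i, u, hu, rfl⟩, h⟩
      exact ⟨⟨i, u, Or.inr hu, rfl⟩, h⟩
  · ext m
    simp only [Bset, Finset.mem_filter, mem_S1mul_aux, Finset.mem_union, mem_degMon_aux,
      x1exp_succ_aux, not_lt]
    constructor
    · rintro ⟨⟨i, u, hu, rfl⟩, h⟩
      refine ⟨?_, h⟩
      have : ∑ i, u i = t := by
        rcases hu with hu | hu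
        · exact hu.1
        · exact mem_degMon_aux.1 (Finset.mem_filter.1 (hX hu)).1
      simp [Finset.sum_add_distrib, this]
    · rintro ⟨hs, h⟩
      refine ⟨?_, h⟩
      have key : ∃ i, 0 < m i ∧ a ≤ (m - Pi.single i 1 : Fin (n+1) → ℕ) 0 := by
        by_cases h0 : ∃ j : Fin n, 0 < m j.succ
        · obtain ⟨j, hj⟩ := h0
          exact ⟨j.succ, hj, by simpa using h⟩
        · push Not at h0
          rw [Fin.sum_univ_succ, Finset.sum_eq_zero (fun j _ => Nat.le_zero.1 (h0 j))] at hs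
          exact ⟨0, by omega, by simp; omega⟩
      obtain ⟨i, hi, hai⟩ := key
      have e : m - Pi.single i 1 + Pi.single i 1 = m := by
        ext j
        by_cases hj : j = i
        · subst hj; simp; omega
        · simp [hj]
      refine ⟨i, m - Pi.single i 1, Or.inl ⟨?_, hai⟩, e⟩
      have : ∑ j, (m - Pi.single i 1 + Pi.single i 1 : Fin (n+1) → ℕ) j = t + 1 := by rw [e]; exact hs
      simp only [Pi.add_apply, Finset.sum_add_distrib, Finset.sum_pi_single',
        Finset.sum_pi_single, Finset.mem_univ, if_true] at this
      simpa using this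

/-- Let `M` be a set of monomials in `R_t` with `t ≥ a`, and let `B` be
the set of degree-`t` monomials of `S` divisible by `x_1^a`.  Then `M` is Gotzmann
in `R_t` if and only if `B ∪ M` is Gotzmann in `S_t`. -/
theorem stmt_5 (n a t : ℕ) (ha : 1 ≤ a) (hta : a ≤ t)
    (M : Finset (Fin n → ℕ)) (hM : M ⊆ RMon n a t) :
    GotzmannR n a t M ↔ GotzmannS n t (Bset n a t ∪ M) := by
  cases n with
  | zero => simp [GotzmannR, GotzmannS, R1mul, S1mul]
  | succ n =>
    unfold GotzmannR GotzmannS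
    rw [Finset.card_union_of_disjoint (disj_aux hM), lexSeg_aux, S1mul_card_aux hta hM,
      S1mul_card_aux hta (X := lexSeg (RMon (n+1) a t) M.card) (Finset.filter_subset _ _)]
    omega
end
end

section
/- Let L be the lexsegment set of size d in R_t with t ≥ a−1 and let j = I(L). Then R_1·L is the disjoint union over j ≤ i ≤ a−1 of the sets S'_1·L^i, where S' = F[x_2,...,x_n]. -/
open scoped Classical
open Finset

noncomputable section

theorem lexLt_trans7 {n : ℕ} {u v w : Fin n → ℕ} (h1 : lexLt u v) (h2 : lexLt v w) :
    lexLt u w := by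
  obtain ⟨i, hi, hi'⟩ := h1
  obtain ⟨j, hj, hj'⟩ := h2
  rcases lt_trichotomy i j with h | h | h
  · exact ⟨i, fun k hk => (hi k hk).trans (hj k (hk.trans h)), by rw [← hj i h]; exact hi'⟩
  · subst h
    exact ⟨i, fun k hk => (hi k hk).trans (hj k hk), hi'.trans hj'⟩
  · exact ⟨j, fun k hk => (hi k (hk.trans h)).trans (hj k hk), by rw [hi j h]; exact hj'⟩

theorem lexSeg_up7 {n : ℕ} {G : Finset (Fin n → ℕ)} {d : ℕ} {m v : Fin n → ℕ}
    (hm : m ∈ lexSeg G d) (hv : v ∈ G) (h : lexLt m v) : v ∈ lexSeg G d := by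
  unfold lexSeg at hm ⊢
  rw [Finset.mem_filter] at hm ⊢
  refine ⟨hv, le_trans (Finset.card_le_card ?_) hm.2⟩
  intro w hw
  rw [Finset.mem_filter] at hw ⊢
  refine ⟨hw.1, Or.inr ?_⟩
  rcases hw.2 with h' | h'
  · rw [← h']; exact h
  · exact lexLt_trans7 h h'

theorem mem_S1'mul7 {n : ℕ} {M : Finset (Fin n → ℕ)} {w : Fin n → ℕ} :
    w ∈ S1'mul n M ↔ ∃ i : Fin n, (i : ℕ) ≠ 0 ∧ ∃ m ∈ M, m + Pi.single i 1 = w := by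
  simp [S1'mul]

theorem x1exp_add7 {n : ℕ} (m : Fin n → ℕ) {i : Fin n} (hi : (i : ℕ) ≠ 0) :
    x1exp (m + Pi.single i 1) = x1exp m := by
  unfold x1exp
  split_ifs with h
  · have : (⟨0, h⟩ : Fin n) ≠ i := fun e => hi (by rw [← e])
    simp [Pi.single_eq_of_ne this]
  · rfl

theorem x1exp_S1'7 {n : ℕ} {M : Finset (Fin n → ℕ)} {w : Fin n → ℕ} {i : ℕ}
    (h : w ∈ S1'mul n (comp M i)) : x1exp w = i := by
  obtain ⟨k, hk, m, hm, rfl⟩ := mem_S1'mul7.1 h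
  rw [x1exp_add7 m hk]
  exact (Finset.mem_filter.1 hm).2

theorem swap7 {n a t d : ℕ} (hn : 0 < n) (ht : a - 1 ≤ t) {m : Fin n → ℕ}
    (hm : m ∈ lexSeg (RMon n a t) d) (h : x1exp (m + Pi.single ⟨0, hn⟩ 1) < a) :
    ∃ k : Fin n, (k : ℕ) ≠ 0 ∧ ∃ m' ∈ lexSeg (RMon n a t) d,
      m' + Pi.single k 1 = m + Pi.single ⟨0, hn⟩ 1 := by
  have hmR : m ∈ RMon n a t := (Finset.mem_filter.1 hm).1
  have hsum : ∑ i, m i = t := by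
    have := (Finset.mem_filter.1 hmR).1
    exact Finset.Nat.mem_antidiagonalTuple.1 this
  have hx : m ⟨0, hn⟩ + 1 < a := by simpa [x1exp, hn] using h
  have hk : ∃ k : Fin n, (k : ℕ) ≠ 0 ∧ m k ≠ 0 := by
    by_contra hc
    push Not at hc
    have : ∑ i, m i = m ⟨0, hn⟩ := by
      apply Finset.sum_eq_single
      · intro b _ hb
        exact hc b (fun e => hb (Fin.ext e))
      · simp
    omega
  obtain ⟨k, hk0, hmk⟩ := hk
  have hne : (⟨0, hn⟩ : Fin n) ≠ k := fun e => hk0 (by rw [← e])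
  have key : (m - Pi.single k 1 + Pi.single ⟨0, hn⟩ 1) + Pi.single k 1
      = m + Pi.single ⟨0, hn⟩ 1 := by
    funext j
    by_cases hj : j = k
    · subst hj
      simp [Pi.single_eq_of_ne hne.symm]
      omega
    · simp [Pi.single_eq_of_ne hj]
  have h0 : (m - Pi.single k 1 + Pi.single ⟨0, hn⟩ 1 : Fin n → ℕ) ⟨0, hn⟩ = m ⟨0, hn⟩ + 1 := by
    simp [Pi.single_eq_of_ne hne]
  refine ⟨k, hk0, _, lexSeg_up7 hm ?_ ?_, key⟩
  · refine Finset.mem_filter.2 ⟨Finset.Nat.mem_antidiagonalTuple.2 ?_, ?_⟩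
    · have := congrArg (fun f : Fin n → ℕ => ∑ i, f i) key
      simp only [Pi.add_apply, Finset.sum_add_distrib, Finset.sum_pi_single', Finset.mem_univ,
        if_true, Finset.sum_pi_single] at this ⊢
      simp at this ⊢
      omega
    · unfold x1exp
      rw [dif_pos hn, h0]; exact hx
  · refine ⟨⟨0, hn⟩, fun j hj => absurd hj (by simp [Fin.lt_def]), ?_⟩
    rw [h0]; omega

/-- Let `L` be the lexsegment set of size `d` in `R_t` with `t ≥ a - 1`
and `j = I(L)`.  Then `R_1·L` is the disjoint union over `j ≤ i ≤ a - 1` of the sets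
`S'_1·L^i`, where `S' = F[x_2,...,x_n]`. -/
theorem stmt_7 (n a t d : ℕ) (hn : 2 ≤ n) (ha : 1 ≤ a) (ht : a - 1 ≤ t)
    (hd0 : 0 < d) (hd : d < (RMon n a t).card) :
    R1mul n a (lexSeg (RMon n a t) d) =
        (Finset.Icc (Imon (lexSeg (RMon n a t) d)) (a - 1)).biUnion
          (fun i => S1'mul n (comp (lexSeg (RMon n a t) d) i)) ∧
      ∀ i ∈ Finset.Icc (Imon (lexSeg (RMon n a t) d)) (a - 1),
        ∀ i' ∈ Finset.Icc (Imon (lexSeg (RMon n a t) d)) (a - 1), i ≠ i' →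
          Disjoint (S1'mul n (comp (lexSeg (RMon n a t) d) i))
            (S1'mul n (comp (lexSeg (RMon n a t) d) i')) := by
  have hn0 : 0 < n := by omega
  constructor
  · ext w
    rw [Finset.mem_biUnion]
    constructor
    · intro hw
      obtain ⟨hw, hwa⟩ := Finset.mem_filter.1 hw
      have : ∃ k : Fin n, (k : ℕ) ≠ 0 ∧ ∃ m' ∈ lexSeg (RMon n a t) d,
          m' + Pi.single k 1 = w := by
        obtain ⟨i, -, hi⟩ := Finset.mem_biUnion.1 hw
        obtain ⟨m, hm, rfl⟩ := Finset.mem_image.1 hi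
        by_cases h0 : (i : ℕ) = 0
        · have : i = ⟨0, hn0⟩ := Fin.ext h0
          subst this
          exact swap7 hn0 ht hm hwa
        · exact ⟨i, h0, m, hm, rfl⟩
      obtain ⟨k, hk, m, hm, rfl⟩ := this
      rw [x1exp_add7 m hk] at hwa
      have hc : m ∈ comp (lexSeg (RMon n a t) d) (x1exp m) :=
        Finset.mem_filter.2 ⟨hm, rfl⟩
      refine ⟨x1exp m, Finset.mem_Icc.2 ⟨Nat.sInf_le ⟨m, hc⟩, by omega⟩, ?_⟩
      exact mem_S1'mul7.2 ⟨k, hk, m, hc, rfl⟩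
    · rintro ⟨i, hi, hw⟩
      have hx := x1exp_S1'7 hw
      obtain ⟨k, hk, m, hm, rfl⟩ := mem_S1'mul7.1 hw
      refine Finset.mem_filter.2 ⟨Finset.mem_biUnion.2 ⟨k, Finset.mem_univ _,
        Finset.mem_image.2 ⟨m, (Finset.mem_filter.1 hm).1, rfl⟩⟩, ?_⟩
      have := (Finset.mem_Icc.1 hi).2
      omega
  · intro i _ i' _ hne
    rw [Finset.disjoint_left]
    intro w h1 h2
    exact hne ((x1exp_S1'7 h1).symm.trans (x1exp_S1'7 h2))
end
end
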